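/- (Lemma 6, left-hand side) For every real x > 0 and with Λ the von Mangoldt function, Σ_{n=1}^∞ (Λ(n)/√n)(G(log n + log x) + G(−log n + log x)) = √x Σ_{n=1}^∞ Λ(n) α(x n) β(1/(x n)) + √x Σ_{n=1}^∞ (Λ(n)/n) α(x/n) β(n/x), all series converging absolutely. -/

import Mathlib

open scoped Real
open Real

noncomputable section

/-- `a(2^l * m) = 2^l * σ₁(m)` for `m` odd; in particular `a(n) = σ₁(n)` for odd `n`. -/
def paperA (n : ℕ) : ℤ :=
  2 ^ (n.factorization 2) * (ArithmeticFunction.sigma 1 (ordCompl[2] n) : ℤ)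

/-- `b(n) = σ₁(n)` for odd `n`, `b(n) = 0` for even `n`. -/
def paperB (n : ℕ) : ℤ :=
  if Odd n then (ArithmeticFunction.sigma 1 n : ℤ) else 0

/-- `α(u) = Σ_{k≥1} a(k) e^{−π k u}`. -/
def alphaFn (u : ℝ) : ℝ := ∑' k : ℕ, (paperA k : ℝ) * Real.exp (-(π * k * u))

/-- `β(u) = Σ_{l≥1} b(l) e^{−π l u}`. -/
def betaFn (u : ℝ) : ℝ := ∑' l : ℕ, (paperB l : ℝ) * Real.exp (-(π * l * u))

/-- `g(v, x) = e^{v/2} exp(−(x/2)(e^v + e^{−v}))`. -/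
def paperg (v x : ℝ) : ℝ :=
  Real.exp (v / 2) * Real.exp (-(x / 2) * (Real.exp v + Real.exp (-v)))

/-- `G(v) = Σ_{j≥1} Σ_{d∣j} a(d) b(j/d) (j/d²)^{1/4} g(v − (1/2)log(j/d²), 2π√j)`. -/
def paperG (v : ℝ) : ℝ :=
  ∑' j : ℕ, ∑ d ∈ j.divisors,
    (paperA d : ℝ) * (paperB (j / d) : ℝ) * ((j : ℝ) / (d : ℝ) ^ 2) ^ ((1 : ℝ) / 4) *
      paperg (v - (1 / 2) * Real.log ((j : ℝ) / (d : ℝ) ^ 2)) (2 * π * Real.sqrt j)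

theorem abs_paperA_le (n : ℕ) : |(paperA n : ℝ)| ≤ (n : ℝ) ^ 2 := by
  have h : 2 ^ n.factorization 2 * ArithmeticFunction.sigma 1 (ordCompl[2] n) ≤ n ^ 2 := by
    rcases Nat.eq_zero_or_pos n with rfl | _
    · simp
    · calc 2 ^ n.factorization 2 * ArithmeticFunction.sigma 1 (ordCompl[2] n)
          ≤ (2 ^ n.factorization 2) ^ 2 * (ordCompl[2] n) ^ 2 :=
            Nat.mul_le_mul (Nat.le_self_pow two_ne_zero _)
              (ArithmeticFunction.sigma_le_pow_succ 1 _)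
        _ = n ^ 2 := by rw [← mul_pow, Nat.ordProj_mul_ordCompl_eq_self]
  have h' : (paperA n : ℝ)
      = ((2 ^ n.factorization 2 * ArithmeticFunction.sigma 1 (ordCompl[2] n) : ℕ) : ℝ) := by
    simp [paperA]
  rw [h', Nat.abs_cast]
  exact_mod_cast h

theorem abs_paperB_le (n : ℕ) : |(paperB n : ℝ)| ≤ (n : ℝ) ^ 2 := by
  unfold paperB
  split_ifs
  · rw [Int.cast_natCast, Nat.abs_cast]
    exact_mod_cast ArithmeticFunction.sigma_le_pow_succ 1 n
  · simp

theorem abs_mul_exp_neg_le {c : ℕ → ℝ} (hc : ∀ n, |c n| ≤ (n : ℝ) ^ 2) {N : ℕ} (hN : 4 ≤ N)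
    {u : ℝ} (hu : 0 < u) (k : ℕ) :
    |c k * Real.exp (-(π * k * u))| ≤ N.factorial / u ^ N * (1 / (k : ℝ) ^ 2) := by
  rcases Nat.eq_zero_or_pos k with rfl | hk
  · simpa using hc 0
  have hk1 : (1 : ℝ) ≤ k := by exact_mod_cast hk
  have hku : (0 : ℝ) < k * u := by positivity
  have hle : (k : ℝ) * u ≤ π * k * u := by nlinarith [Real.pi_gt_three]
  have hexp : Real.exp (-(π * k * u)) ≤ N.factorial / (k * u) ^ N :=
    calc Real.exp (-(π * k * u)) ≤ Real.exp (-(k * u)) := by gcongr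
      _ = (Real.exp (k * u))⁻¹ := Real.exp_neg _
      _ ≤ ((k * u) ^ N / N.factorial)⁻¹ :=
          inv_anti₀ (by positivity) (Real.pow_div_factorial_le_exp _ hku.le N)
      _ = N.factorial / (k * u) ^ N := inv_div _ _
  rw [abs_mul, Real.abs_exp]
  calc |c k| * Real.exp (-(π * k * u)) ≤ (k : ℝ) ^ 2 * (N.factorial / (k * u) ^ N) := by
        gcongr
        exact hc k
    _ = N.factorial / u ^ N * ((k : ℝ) ^ 2 / (k : ℝ) ^ N) := by
        rw [mul_pow]; field_simp
    _ ≤ N.factorial / u ^ N * ((k : ℝ) ^ 2 / (k : ℝ) ^ 4) := by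
        gcongr
    _ = N.factorial / u ^ N * (1 / (k : ℝ) ^ 2) := by
        field_simp

theorem summable_abs_mul_exp_neg {c : ℕ → ℝ} (hc : ∀ n, |c n| ≤ (n : ℝ) ^ 2) {u : ℝ}
    (hu : 0 < u) : Summable fun k : ℕ => |c k * Real.exp (-(π * k * u))| :=
  Summable.of_nonneg_of_le (fun _ => abs_nonneg _) (abs_mul_exp_neg_le hc le_rfl hu)
    ((Real.summable_one_div_nat_pow.2 one_lt_two).mul_left _)

theorem exists_abs_tsum_mul_exp_neg_le {c : ℕ → ℝ} (hc : ∀ n, |c n| ≤ (n : ℝ) ^ 2) {N : ℕ}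
    (hN : 4 ≤ N) :
    ∃ C : ℝ, 0 ≤ C ∧ ∀ u : ℝ, 0 < u →
      |∑' k : ℕ, c k * Real.exp (-(π * k * u))| ≤ C / u ^ N := by
  refine ⟨N.factorial * ∑' k : ℕ, 1 / (k : ℝ) ^ 2,
    mul_nonneg (by positivity) (tsum_nonneg fun k => by positivity), fun u hu => ?_⟩
  have hs := (Real.summable_one_div_nat_pow.2 one_lt_two).mul_left (N.factorial / u ^ N)
  have h := tsum_of_norm_bounded hs.hasSum fun k =>
    (Real.norm_eq_abs _).trans_le (abs_mul_exp_neg_le hc hN hu k)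
  rw [tsum_mul_left] at h
  rw [mul_div_right_comm]
  exact h

theorem tsum_mul_tsum_eq_tsum_sum_divisors {f g : ℕ → ℝ} (hf : Summable fun n => |f n|)
    (hg : Summable fun n => |g n|) (hf0 : f 0 = 0) (hg0 : g 0 = 0) :
    (∑' n, f n) * ∑' n, g n = ∑' j : ℕ, ∑ d ∈ j.divisors, f d * g (j / d) := by
  have hsum : Summable fun p : ℕ × ℕ => f p.1 * g p.2 :=
    summable_mul_of_summable_norm (by simpa only [Real.norm_eq_abs] using hf)
      (by simpa only [Real.norm_eq_abs] using hg)
  have h := ((hf.of_abs.hasSum.mul hg.of_abs.hasSum hsum).tsum_fiberwise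
    fun p : ℕ × ℕ => p.1 * p.2).tsum_eq
  rw [← h]
  congr 1
  ext n
  rw [← Nat.sum_divisorsAntidiagonal fun a b => f a * g b]
  rcases eq_or_ne n 0 with rfl | hn
  · have h0 : ∀ p : (fun p : ℕ × ℕ => p.1 * p.2) ⁻¹' {0}, f p.val.1 * g p.val.2 = 0 := by
      rintro ⟨⟨a, b⟩, hp⟩
      rcases Nat.mul_eq_zero.1 hp with rfl | rfl <;> simp [hf0, hg0]
    simp [h0]
  · rw [show (fun p : ℕ × ℕ => p.1 * p.2) ⁻¹' {n} = n.divisorsAntidiagonal by ext; simp [hn],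
      Finset.tsum_subtype' n.divisorsAntidiagonal fun p => f p.1 * g p.2]

theorem rpow_mul_paperg_eq {k l y : ℝ} (hk : 0 < k) (hl : 0 < l) (hy : 0 < y) :
    (k * l / k ^ 2) ^ ((1 : ℝ) / 4) *
        paperg (Real.log y - 1 / 2 * Real.log (k * l / k ^ 2)) (2 * π * Real.sqrt (k * l)) =
      Real.sqrt y * (Real.exp (-(π * k * y)) * Real.exp (-(π * l * (1 / y)))) := by
  have hr : k * l / k ^ 2 = l / k := by field_simp
  have hlk : 0 < l / k := by positivity
  set w := Real.log y - 1 / 2 * Real.log (l / k) with hw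
  have hew : Real.exp w = y * (Real.sqrt k / Real.sqrt l) := by
    rw [hw, Real.exp_sub, Real.exp_log hy, one_div_mul_eq_div, ← Real.log_sqrt hlk.le,
      Real.exp_log (Real.sqrt_pos.2 hlk), Real.sqrt_div hl.le]
    field_simp
  have hhalf : (l / k) ^ ((1 : ℝ) / 4) * Real.exp (w / 2) = Real.sqrt y := by
    rw [Real.rpow_def_of_pos hlk, ← Real.exp_add, Real.sqrt_eq_rpow, Real.rpow_def_of_pos hy, hw]
    congr 1
    ring
  have hsk : Real.sqrt k ^ 2 = k := Real.sq_sqrt hk.le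
  have hsl : Real.sqrt l ^ 2 = l := Real.sq_sqrt hl.le
  have hk' := Real.sqrt_pos.2 hk
  have hl' := Real.sqrt_pos.2 hl
  rw [hr, paperg, ← mul_assoc, hhalf, ← Real.exp_add, Real.exp_neg, hew, Real.sqrt_mul hk.le]
  congr 2
  field_simp
  rw [hsk, hsl]
  ring

theorem paperG_log {y : ℝ} (hy : 0 < y) :
    paperG (Real.log y) = Real.sqrt y * (alphaFn y * betaFn (1 / y)) := by
  have hy' : 0 < 1 / y := by positivity
  have ha := summable_abs_mul_exp_neg abs_paperA_le hy
  have hb := summable_abs_mul_exp_neg abs_paperB_le hy'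
  rw [alphaFn, betaFn, tsum_mul_tsum_eq_tsum_sum_divisors ha hb (by simp [paperA])
    (by simp [paperB]), ← tsum_mul_left, paperG]
  congr 1
  ext j
  rw [Finset.mul_sum]
  refine Finset.sum_congr rfl fun d hd => ?_
  have hd0 : 0 < d := Nat.pos_of_mem_divisors hd
  obtain ⟨⟨e, rfl⟩, hj⟩ := Nat.mem_divisors.1 hd
  have he0 : 0 < e := Nat.pos_of_ne_zero fun h => hj (by simp [h])
  rw [Nat.mul_div_cancel_left e hd0, mul_assoc, Nat.cast_mul,
    rpow_mul_paperg_eq (Nat.cast_pos.2 hd0) (Nat.cast_pos.2 he0) hy]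
  ring

open ArithmeticFunction in
theorem vonMangoldt_le_natCast (n : ℕ) : vonMangoldt n ≤ n :=
  vonMangoldt_le_log.trans (Real.log_le_self n.cast_nonneg)

theorem summable_abs_mul_alphaFn_mul_betaFn {c s t : ℕ → ℝ}
    (hc : ∀ n, |c n| ≤ n) (hc0 : c 0 = 0) {M N : ℕ} (hM : 4 ≤ M) (hN : 4 ≤ N)
    {K : ℝ} (hs : ∀ n, 0 < n → 0 < s n) (ht : ∀ n, 0 < n → 0 < t n)
    (h : ∀ n, 0 < n → 1 / (s n ^ M * t n ^ N) ≤ K / (n : ℝ) ^ 3) :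
    Summable fun n : ℕ => |c n * alphaFn (s n) * betaFn (t n)| := by
  obtain ⟨A, hA0, hA⟩ := exists_abs_tsum_mul_exp_neg_le abs_paperA_le hM
  obtain ⟨B, hB0, hB⟩ := exists_abs_tsum_mul_exp_neg_le abs_paperB_le hN
  refine Summable.of_nonneg_of_le (fun _ => abs_nonneg _) (fun n => ?_)
    ((Real.summable_one_div_nat_pow.2 one_lt_two).mul_left (A * B * K))
  rcases Nat.eq_zero_or_pos n with rfl | hn
  · simp [hc0]
  have hs' := hs n hn
  have ht' := ht n hn
  rw [abs_mul, abs_mul]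
  calc |c n| * |alphaFn (s n)| * |betaFn (t n)|
      ≤ n * (A / s n ^ M) * (B / t n ^ N) := by
        gcongr
        · exact hc n
        · exact hA _ hs'
        · exact hB _ ht'
    _ = n * (A * B) * (1 / (s n ^ M * t n ^ N)) := by field_simp
    _ ≤ n * (A * B) * (K / (n : ℝ) ^ 3) := by gcongr ?_ * ?_; exact h n hn
    _ = A * B * K * (1 / (n : ℝ) ^ 2) := by field_simp

open ArithmeticFunction in
theorem lemma_six_lhs (x : ℝ) (hx : 0 < x) :
    Summable (fun n : ℕ =>
      |(vonMangoldt n / Real.sqrt n) *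
        (paperG (Real.log n + Real.log x) + paperG (-Real.log n + Real.log x))|) ∧
    Summable (fun n : ℕ => |vonMangoldt n * alphaFn (x * n) * betaFn (1 / (x * n))|) ∧
    Summable (fun n : ℕ => |(vonMangoldt n / n) * alphaFn (x / n) * betaFn (n / x)|) ∧
    ∑' n : ℕ, (vonMangoldt n / Real.sqrt n) *
        (paperG (Real.log n + Real.log x) + paperG (-Real.log n + Real.log x)) =
      Real.sqrt x * ∑' n : ℕ, vonMangoldt n * alphaFn (x * n) * betaFn (1 / (x * n)) +
        Real.sqrt x * ∑' n : ℕ, (vonMangoldt n / n) * alphaFn (x / n) * betaFn (n / x) := by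
  have h₁ : Summable fun n : ℕ => |vonMangoldt n * alphaFn (x * n) * betaFn (1 / (x * n))| := by
    refine summable_abs_mul_alphaFn_mul_betaFn (M := 7) (N := 4) (K := 1 / x ^ 3)
      (fun n => ?_) (by simp) (by norm_num) le_rfl (fun n hn => by positivity)
      (fun n hn => by positivity) (fun n hn => le_of_eq ?_)
    · rw [abs_of_nonneg vonMangoldt_nonneg]
      exact vonMangoldt_le_natCast n
    · field_simp
  have h₂ : Summable fun n : ℕ => |(vonMangoldt n / n) * alphaFn (x / n) * betaFn (n / x)| := by
    refine summable_abs_mul_alphaFn_mul_betaFn (M := 4) (N := 7) (K := x ^ 3)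
      (fun n => ?_) (by simp) le_rfl (by norm_num) (fun n hn => by positivity)
      (fun n hn => by positivity) (fun n hn => le_of_eq ?_)
    · rw [abs_of_nonneg (div_nonneg vonMangoldt_nonneg n.cast_nonneg)]
      rcases Nat.eq_zero_or_pos n with rfl | hn
      · simp
      · exact (div_le_self vonMangoldt_nonneg (by exact_mod_cast hn)).trans
          (vonMangoldt_le_natCast n)
    · field_simp
  have key : ∀ n : ℕ, (vonMangoldt n / Real.sqrt n) *
        (paperG (Real.log n + Real.log x) + paperG (-Real.log n + Real.log x)) =
      Real.sqrt x * (vonMangoldt n * alphaFn (x * n) * betaFn (1 / (x * n))) +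
        Real.sqrt x * ((vonMangoldt n / n) * alphaFn (x / n) * betaFn (n / x)) := by
    intro n
    rcases Nat.eq_zero_or_pos n with rfl | hn
    · simp
    have hn' : (0 : ℝ) < n := Nat.cast_pos.2 hn
    have hsn : 0 < Real.sqrt n := Real.sqrt_pos.2 hn'
    have hsq : Real.sqrt n ^ 2 = n := Real.sq_sqrt hn'.le
    rw [add_comm (Real.log n), neg_add_eq_sub, ← Real.log_mul hx.ne' hn'.ne',
      ← Real.log_div hx.ne' hn'.ne', paperG_log (by positivity), paperG_log (by positivity),
      one_div_div, Real.sqrt_mul hx.le, Real.sqrt_div hx.le]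
    have hdiv : vonMangoldt n / (n : ℝ) = vonMangoldt n / Real.sqrt n / Real.sqrt n := by
      rw [div_div, ← sq, hsq]
    rw [hdiv]
    field_simp
  have e₁ := h₁.of_abs.mul_left (Real.sqrt x)
  have e₂ := h₂.of_abs.mul_left (Real.sqrt x)
  refine ⟨?_, h₁, h₂, ?_⟩
  · simp_rw [key]
    exact (e₁.add e₂).abs
  · simp_rw [key]
    rw [e₁.tsum_add e₂, tsum_mul_left, tsum_mul_left]
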